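/- arXiv:2305.19338 — 2 statements merged into one kernel-verified Lean document; each statement's English description precedes it below -/
import Mathlib

section
/- Let $n \geq 1$, let $\underline{k}=(k_1,\dots,k_n)$ and $\underline{m}=(m_1,\dots,m_n)$ be tuples of natural numbers such that for every $i$, $k_i \geq 5$ and $1 \leq m_i \leq \sqrt{k_i}$. Then for every finite intersection-closed family $\mathcal{F} \subseteq 2^{[n]}$ with $|\mathcal{F}| \geq 2$, there exists $i \in \bigcup_{A \in \mathcal{F}} A$ such that $\frac{\sum_{A\in\mathcal{F}: i\notin A}\prod_{j\in A} m_j/k_j}{\sum_{A\in\mathcal{F}}\prod_{j\in A} m_j/k_j} \geq \frac{1}{2}$. -/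
open Real

noncomputable def hTwo (a b : ℝ) : ℝ := negMulLog a + negMulLog b - negMulLog (a + b)

lemma hTwo_mul (t a b : ℝ) : hTwo (t * a) (t * b) = t * hTwo a b := by
  unfold hTwo
  rw [← mul_add, negMulLog_mul, negMulLog_mul, negMulLog_mul]; ring

lemma hTwo_bin (p : ℝ) : hTwo (1 - p) p = binEntropy p := by
  unfold hTwo
  rw [binEntropy_eq_negMulLog_add_negMulLog_one_sub]; simp [add_comm]

lemma hTwo_eq {a b : ℝ} (h : a + b ≠ 0) : hTwo a b = (a + b) * binEntropy (b / (a + b)) := by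
  rw [← hTwo_bin, ← hTwo_mul]; congr 1 <;> field_simp
  ring

lemma hTwo_super {a b a' b' : ℝ} (ha : 0 ≤ a) (hb : 0 ≤ b) (ha' : 0 ≤ a') (hb' : 0 ≤ b') :
    hTwo a b + hTwo a' b' ≤ hTwo (a + a') (b + b') := by
  by_cases h : a + b = 0
  · have h1 : a = 0 := by linarith
    have h2 : b = 0 := by linarith
    subst h1 h2; simp [hTwo]
  by_cases h' : a' + b' = 0
  · have h1 : a' = 0 := by linarith
    have h2 : b' = 0 := by linarith
    subst h1 h2; simp [hTwo]
  have p : 0 < a + b := lt_of_le_of_ne (by linarith) (Ne.symm h)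
  have p' : 0 < a' + b' := lt_of_le_of_ne (by linarith) (Ne.symm h')
  rw [hTwo_eq h, hTwo_eq h', hTwo_eq (by linarith : a + a' + (b + b') ≠ 0)]
  have hs : 0 < a + a' + (b + b') := by linarith
  have key := strictConcave_binEntropy.concaveOn.2
    (show b / (a + b) ∈ Set.Icc 0 1 from ⟨by positivity, by rw [div_le_one p]; linarith⟩)
    (show b' / (a' + b') ∈ Set.Icc 0 1 from ⟨by positivity, by rw [div_le_one p']; linarith⟩)
    (show 0 ≤ (a + b) / (a + a' + (b + b')) by positivity)
    (show 0 ≤ (a' + b') / (a + a' + (b + b')) by positivity) (by field_simp; ring)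
  simp only [smul_eq_mul] at key
  have e : (a + b) / (a + a' + (b + b')) * (b / (a + b)) + (a' + b') / (a + a' + (b + b')) * (b' / (a' + b')) = (b + b') / (a + a' + (b + b')) := by
    field_simp
  rw [e] at key
  have := mul_le_mul_of_nonneg_left key hs.le
  refine le_trans (le_of_eq ?_) this
  field_simp

lemma hTwo_sum {ι : Type*} (s : Finset ι) (f g : ι → ℝ) (hf : ∀ i, 0 ≤ f i) (hg : ∀ i, 0 ≤ g i) :
    ∑ i ∈ s, hTwo (f i) (g i) ≤ hTwo (∑ i ∈ s, f i) (∑ i ∈ s, g i) := by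
  classical
  induction s using Finset.induction_on with
  | empty => simp [hTwo]
  | insert i s hi ih =>
    simp only [Finset.sum_insert hi]
    refine le_trans ?_ (hTwo_super (hf i) (hg i) (Finset.sum_nonneg fun i _ => hf i) (Finset.sum_nonneg fun i _ => hg i))
    linarith

lemma log_le_half {y : ℝ} (hy : 1 ≤ y) : log y ≤ (y - y⁻¹) / 2 := by
  rw [← sinh_log (by linarith)]
  exact self_le_sinh_iff.2 (log_nonneg hy)

lemma one_var {x : ℝ} (h0 : 0 < x) (h1 : x < 1) :
    3 / 2 * (x * binEntropy x) ≤ binEntropy (x * x) := by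
  have hb : 2 * x / (2 - x) ≤ - log (1 - x) := by
    have h2 : 0 < 1 - x := by linarith
    have := le_log_one_add_of_nonneg (x := x / (1 - x)) (by positivity)
    have e1 : 1 + x / (1 - x) = (1 - x)⁻¹ := by field_simp; ring
    rw [e1, log_inv] at this
    refine le_trans (le_of_eq ?_) this
    have h3 : 2 - x ≠ 0 := by linarith
    have h4 : x / (1 - x) + 2 = (2 - x) / (1 - x) := by field_simp; ring
    rw [h4]; field_simp
  have hd : log (1 + x) ≤ x * (x + 2) / (2 * (1 + x)) := by
    refine (log_le_half (by linarith)).trans (le_of_eq ?_)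
    field_simp; ring
  have ha : 1 - x ≤ - log x := by linarith [log_le_sub_one_of_pos h0]
  have e : log (1 - x * x) = log (1 - x) + log (1 + x) := by
    rw [← log_mul (by linarith) (by linarith)]; ring_nf
  rw [binEntropy_eq_negMulLog_add_negMulLog_one_sub, binEntropy_eq_negMulLog_add_negMulLog_one_sub]
  unfold negMulLog
  rw [e, log_mul h0.ne' h0.ne']
  have hb' : x ≤ (1 - x / 2) * (- log (1 - x)) := by
    rw [div_le_iff₀ (by linarith)] at hb; linarith
  have hd' : (1 + x) * log (1 + x) ≤ x + x * x / 2 := by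
    rw [le_div_iff₀ (by linarith)] at hd; linarith
  nlinarith [mul_nonneg (sub_nonneg.2 h1.le) (sub_nonneg.2 hb'), mul_nonneg (sub_nonneg.2 h1.le) (sub_nonneg.2 hd'), mul_nonneg (mul_nonneg h0.le h0.le) (sub_nonneg.2 ha)]

lemma G_concave : ConcaveOn ℝ (Set.Ioi 0) (fun s : ℝ => (exp s - 1) * (- log (1 - exp (-s)))) := by
  have hd : ∀ s ∈ Set.Ioi (0:ℝ), HasDerivAt (fun s : ℝ => (exp s - 1) * (- log (1 - exp (-s))))
      (exp s * (- log (1 - exp (-s))) - 1) s := by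
    intro s hs
    have hs' : 0 < 1 - exp (-s) := by
      have : exp (-s) < 1 := by rw [exp_lt_one_iff]; simpa using hs
      linarith
    have h1 : HasDerivAt (fun s : ℝ => exp s - 1) (exp s) s := (Real.hasDerivAt_exp s).sub_const 1
    have h2 : HasDerivAt (fun s : ℝ => exp (-s)) (exp (-s) * (-1)) s := (hasDerivAt_neg s).exp
    have h3 := ((h2.const_sub 1).log hs'.ne').neg
    refine HasDerivAt.congr_deriv (h1.mul h3) ?_
    have : exp s * exp (-s) = 1 := by rw [← exp_add]; simp
    have h5 : exp (-s) = (exp s)⁻¹ := exp_neg s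
    have h6 : (exp s - 1) * exp (-s) / (1 - exp (-s)) = 1 := by
      rw [div_eq_one_iff_eq hs'.ne']; linear_combination this
    simp only [mul_neg, neg_neg, mul_one]
    linear_combination -h6
  refine AntitoneOn.concaveOn_of_deriv (convex_Ioi 0) (fun s hs => (hd s hs).continuousAt.continuousWithinAt) ?_ ?_
  · rw [interior_Ioi]; exact fun s hs => (hd s hs).differentiableAt.differentiableWithinAt
  · rw [interior_Ioi]
    intro s hs t ht hst
    rw [(hd s hs).deriv, (hd t ht).deriv]
    simp only [Set.mem_Ioi] at hs ht
    rcases hst.eq_or_lt with rfl | hst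
    · rfl
    have a1 : exp (-t) < exp (-s) := exp_lt_exp.2 (by linarith)
    have a2 : exp (-s) < 1 := by rw [exp_lt_one_iff]; linarith
    have a0 := exp_pos (-t)
    have b1 : exp s = (exp (-s))⁻¹ := by rw [exp_neg, inv_inv]
    have b2 : exp t = (exp (-t))⁻¹ := by rw [exp_neg, inv_inv]
    rw [b1, b2]
    generalize exp (-s) = p at *
    generalize exp (-t) = q at *
    have hp : 0 < p := by linarith
    have key := strictConcaveOn_log_Ioi.concaveOn.2 (show (1:ℝ) ∈ Set.Ioi 0 by simp)
      (show 1 - p ∈ Set.Ioi 0 by simpa using a2)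
      (show 0 ≤ 1 - q / p by rw [sub_nonneg, div_le_one hp]; exact a1.le) (show 0 ≤ q / p by positivity) (by ring)
    simp only [smul_eq_mul, log_one, mul_zero, zero_add] at key
    have e : (1 - q / p) * 1 + q / p * (1 - p) = 1 - q := by field_simp; ring
    rw [e] at key
    have : q⁻¹ * (-log (1 - q)) ≤ p⁻¹ * (-log (1-p)) := by
      have := mul_le_mul_of_nonneg_left key (inv_pos.2 a0).le
      have e2 : q⁻¹ * (q / p * log (1 - p)) = p⁻¹ * log (1 - p) := by field_simp
      linarith
    linarith

lemma two_var {p q : ℝ} (hp : 0 ≤ p) (hp1 : p ≤ 1) (hq : 0 ≤ q) (hq1 : q ≤ 1) :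
    3 / 4 * (p * binEntropy q + q * binEntropy p) ≤ binEntropy (p * q) := by
  rcases hp.eq_or_lt with rfl | hp
  · simp
  rcases hq.eq_or_lt with rfl | hq
  · simp
  rcases hp1.eq_or_lt with rfl | hp1
  · simp; linarith [binEntropy_nonneg hq.le hq1]
  rcases hq1.eq_or_lt with rfl | hq1
  · simp; linarith [binEntropy_nonneg hp.le hp1.le]
  set x := sqrt (p * q) with hx
  have hpq : 0 < p * q := by positivity
  have hxx : x * x = p * q := mul_self_sqrt hpq.le
  have hx0 : 0 < x := sqrt_pos.2 hpq
  have hx1 : x < 1 := by nlinarith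
  have h1 := one_var hx0 hx1
  rw [hxx] at h1
  have key := G_concave.2 (show - log p ∈ Set.Ioi 0 by simpa using log_neg hp hp1)
    (show - log q ∈ Set.Ioi 0 by simpa using log_neg hq hq1)
    (show (0:ℝ) ≤ 1/2 by norm_num) (show (0:ℝ) ≤ 1/2 by norm_num) (by norm_num)
  have lx : log x = (log p + log q) / 2 := by
    rw [hx, log_sqrt hpq.le, log_mul hp.ne' hq.ne']
  have e : (1/2 : ℝ) • (- log p) + (1/2 : ℝ) • (- log q) = - log x := by
    simp only [smul_eq_mul]; rw [lx]; ring
  rw [e] at key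
  simp only [neg_neg, exp_neg, exp_log hp, exp_log hq, exp_log hx0, smul_eq_mul] at key
  have : p * binEntropy q + q * binEntropy p ≤ 2 * (x * binEntropy x) := by
    simp only [binEntropy_eq_negMulLog_add_negMulLog_one_sub, negMulLog]
    have := mul_le_mul_of_nonneg_left key hpq.le
    have e1 : p * q * (1/2 * ((p⁻¹ - 1) * -log (1 - p)) + 1/2 * ((q⁻¹ - 1) * -log (1 - q))) =
      1/2 * (q * (1 - p) * - log (1-p) + p * (1-q) * - log (1-q)) := by field_simp
    have e2 : p * q * ((x⁻¹ - 1) * -log (1 - x)) = x * (1-x) * - log (1-x) := by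
      rw [← hxx]; field_simp
    rw [e1, e2] at this
    have : x * (-x * log x) = - (p * q) * ((log p + log q)/2) := by rw [← lx, ← hxx]; ring
    linarith
  linarith

lemma pair_ineq {a b a' b' : ℝ} (ha : 0 ≤ a) (hb : 0 ≤ b) (ha' : 0 ≤ a') (hb' : 0 ≤ b') :
    3 / 4 * (b * hTwo a' b' + b' * hTwo a b) ≤ hTwo (a * a' + a * b' + b * a') (b * b') := by
  by_cases h : a + b = 0
  · have h1 : a = 0 := by linarith
    have h2 : b = 0 := by linarith
    subst h1 h2; simp [hTwo]
  by_cases h' : a' + b' = 0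
  · have h1 : a' = 0 := by linarith
    have h2 : b' = 0 := by linarith
    subst h1 h2; simp [hTwo]
  have p : 0 < a + b := lt_of_le_of_ne (by linarith) (Ne.symm h)
  have p' : 0 < a' + b' := lt_of_le_of_ne (by linarith) (Ne.symm h')
  have e : a * a' + a * b' + b * a' + b * b' = (a + b) * (a' + b') := by ring
  rw [hTwo_eq h, hTwo_eq h', hTwo_eq (by rw [e]; positivity), e]
  have key := two_var (p := b / (a + b)) (q := b' / (a' + b')) (by positivity) (by rw [div_le_one p]; linarith)
    (by positivity) (by rw [div_le_one p']; linarith)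
  have := mul_le_mul_of_nonneg_left key (mul_pos p p').le
  rw [div_mul_div_comm] at this
  refine le_trans (le_of_eq ?_) this
  field_simp

lemma hTwo_nonneg {a b : ℝ} (ha : 0 ≤ a) (hb : 0 ≤ b) : 0 ≤ hTwo a b := by
  by_cases h : a + b = 0
  · have h1 : a = 0 := by linarith
    have h2 : b = 0 := by linarith
    subst h1 h2; simp [hTwo]
  have p : 0 < a + b := lt_of_le_of_ne (by linarith) (Ne.symm h)
  rw [hTwo_eq h]
  exact mul_nonneg p.le (binEntropy_nonneg (by positivity) (by rw [div_le_one p]; linarith))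

lemma coord_step {ι : Type*} (T : Finset ι) (f g : ι → ℝ) (hf : ∀ i, 0 ≤ f i) (hg : ∀ i, 0 ≤ g i)
    (h1 : ∑ A ∈ T, (f A + g A) = 1) (hm : ∑ A ∈ T, g A = 0 ∨ 1 / 2 ≤ ∑ A ∈ T, g A) :
    ∑ A ∈ T, hTwo (f A) (g A) ≤
      ∑ A ∈ T, ∑ B ∈ T, hTwo (f A * f B + f A * g B + g A * f B) (g A * g B) +
      log 2 * ((∑ A ∈ T, g A) * (1 - ∑ A ∈ T, g A)) := by
  have hs := hTwo_sum T f g hf hg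
  have hn : 0 ≤ ∑ A ∈ T, hTwo (f A) (g A) := Finset.sum_nonneg fun i _ => hTwo_nonneg (hf i) (hg i)
  have hp : 3 / 2 * ((∑ A ∈ T, g A) * ∑ A ∈ T, hTwo (f A) (g A)) ≤
      ∑ A ∈ T, ∑ B ∈ T, hTwo (f A * f B + f A * g B + g A * f B) (g A * g B) := by
    have : ∑ A ∈ T, ∑ B ∈ T, 3 / 4 * (g A * hTwo (f B) (g B) + g B * hTwo (f A) (g A)) ≤
      ∑ A ∈ T, ∑ B ∈ T, hTwo (f A * f B + f A * g B + g A * f B) (g A * g B) :=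
      Finset.sum_le_sum fun A _ => Finset.sum_le_sum fun B _ => pair_ineq (hf A) (hg A) (hf B) (hg B)
    refine le_trans (le_of_eq ?_) this
    simp only [← Finset.mul_sum, Finset.sum_add_distrib, ← Finset.sum_mul]
    ring
  rw [Finset.sum_add_distrib] at h1
  have e : ∑ A ∈ T, f A = 1 - ∑ A ∈ T, g A := by linarith
  rw [e, hTwo_bin] at hs
  have hf0 : 0 ≤ ∑ A ∈ T, f A := Finset.sum_nonneg fun i _ => hf i
  have hl : 0 < log 2 := log_pos (by norm_num)
  have hb := binEntropy_le_log_two (p := ∑ A ∈ T, g A)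
  generalize (∑ A ∈ T, g A) = m at *
  generalize (∑ A ∈ T, hTwo (f A) (g A)) = H at *
  rcases hm with rfl | hm
  · simp at hs hp ⊢; linarith
  · refine le_trans ?_ (add_le_add_left hp _)
    have hm1 : m ≤ 1 := by linarith
    by_cases h : 3 / 2 * m ≤ 1
    · have : (1 - 3 / 2 * m) * H ≤ (1 - 3 / 2 * m) * log 2 :=
        mul_le_mul_of_nonneg_left (hs.trans hb) (by linarith)
      have : 0 ≤ (m - 1 / 2) * (2 - m) * log 2 :=
        mul_nonneg (mul_nonneg (by linarith) (by linarith)) hl.le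
      nlinarith
    · have h3 : 0 ≤ (3 / 2 * m - 1) * H := mul_nonneg (by linarith) hn
      have h4 : 0 ≤ log 2 * (m * (1 - m)) := mul_nonneg hl.le (mul_nonneg (by linarith) (by linarith))
      linarith

section
variable {ι : Type*} [DecidableEq ι]

/-- The law of the intersection of two independent samples. -/
noncomputable def capLaw (f : Finset ι → ℝ) (S C : Finset ι) : ℝ :=
  ∑ A ∈ S.powerset, ∑ B ∈ S.powerset, if A ∩ B = C then f A * f B else 0

lemma cap_facts {S : Finset ι} {j : ι} (hj : j ∉ S) {A B C : Finset ι} (hA : A ⊆ S) (hB : B ⊆ S)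
    (hC : C ⊆ S) : A ∩ insert j B = A ∩ B ∧ insert j A ∩ B = A ∩ B ∧ 
    insert j A ∩ insert j B = insert j (A ∩ B) ∧ insert j (A ∩ B) ≠ C ∧ A ∩ B ≠ insert j C ∧
    (insert j (A ∩ B) = insert j C ↔ A ∩ B = C) := by
  have jA : j ∉ A := fun h => hj (hA h)
  have jB : j ∉ B := fun h => hj (hB h)
  have jC : j ∉ C := fun h => hj (hC h)
  have jAB : j ∉ A ∩ B := fun h => jA (Finset.mem_inter.1 h).1
  refine ⟨Finset.inter_insert_of_notMem jA, Finset.insert_inter_of_notMem jB,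
    (Finset.insert_inter_distrib _ _ _).symm, ?_, ?_, ?_⟩
  · rintro rfl; exact jC (Finset.mem_insert_self _ _)
  · intro h; rw [h] at jAB; exact jAB (Finset.mem_insert_self _ _)
  · constructor
    · intro h
      rw [← Finset.erase_insert jAB, h, Finset.erase_insert jC]
    · rintro rfl; rfl

lemma capLaw_one {S : Finset ι} {j : ι} (hj : j ∉ S) (f : Finset ι → ℝ) {C : Finset ι} (hC : C ⊆ S) :
    capLaw f (insert j S) (insert j C) = ∑ A ∈ S.powerset, ∑ B ∈ S.powerset,
      if A ∩ B = C then f (insert j A) * f (insert j B) else 0 := by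
  unfold capLaw
  rw [Finset.sum_powerset_insert hj, ← Finset.sum_add_distrib]
  refine Finset.sum_congr rfl fun A hA => ?_
  rw [Finset.sum_powerset_insert hj, Finset.sum_powerset_insert hj, ← Finset.sum_add_distrib,
    ← Finset.sum_add_distrib, ← Finset.sum_add_distrib]
  refine Finset.sum_congr rfl fun B hB => ?_
  obtain ⟨h1, h2, h3, h4, h5, h6⟩ := cap_facts hj (Finset.mem_powerset.1 hA) (Finset.mem_powerset.1 hB) hC
  simp [h1, h2, h3, h5, h6]

lemma capLaw_zero {S : Finset ι} {j : ι} (hj : j ∉ S) (f : Finset ι → ℝ) {C : Finset ι} (hC : C ⊆ S) :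
    capLaw f (insert j S) C = ∑ A ∈ S.powerset, ∑ B ∈ S.powerset,
      if A ∩ B = C then f A * f B + f A * f (insert j B) + f (insert j A) * f B else 0 := by
  unfold capLaw
  rw [Finset.sum_powerset_insert hj, ← Finset.sum_add_distrib]
  refine Finset.sum_congr rfl fun A hA => ?_
  rw [Finset.sum_powerset_insert hj, Finset.sum_powerset_insert hj, ← Finset.sum_add_distrib,
    ← Finset.sum_add_distrib, ← Finset.sum_add_distrib]
  refine Finset.sum_congr rfl fun B hB => ?_
  obtain ⟨h1, h2, h3, h4, h5, h6⟩ := cap_facts hj (Finset.mem_powerset.1 hA) (Finset.mem_powerset.1 hB) hC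
  simp only [h1, h2, h3, h4, if_false]
  split_ifs <;> ring

lemma hTwo_capLaw {S : Finset ι} {j : ι} (hj : j ∉ S) (f : Finset ι → ℝ) (hf : ∀ A, 0 ≤ f A) :
    ∑ A ∈ S.powerset, ∑ B ∈ S.powerset,
      hTwo (f A * f B + f A * f (insert j B) + f (insert j A) * f B) (f (insert j A) * f (insert j B))
    ≤ ∑ C ∈ S.powerset, hTwo (capLaw f (insert j S) C) (capLaw f (insert j S) (insert j C)) := by
  have step : ∀ C ∈ S.powerset, ∑ A ∈ S.powerset, ∑ B ∈ S.powerset, (if A ∩ B = C then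
      hTwo (f A * f B + f A * f (insert j B) + f (insert j A) * f B) (f (insert j A) * f (insert j B)) else 0)
      ≤ hTwo (capLaw f (insert j S) C) (capLaw f (insert j S) (insert j C)) := by
    intro C hC
    rw [capLaw_one hj f (Finset.mem_powerset.1 hC), capLaw_zero hj f (Finset.mem_powerset.1 hC)]
    rw [← Finset.sum_product', ← Finset.sum_product', ← Finset.sum_product']
    refine le_trans (le_of_eq ?_) (hTwo_sum _ _ _ ?_ ?_)
    · refine Finset.sum_congr rfl fun x _ => ?_
      split_ifs
      · rfl
      · simp [hTwo]
    · intro x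
      have := hf x.1; have := hf x.2; have := hf (insert j x.1); have := hf (insert j x.2)
      split_ifs <;> positivity
    · intro x
      have := hf x.1; have := hf x.2; have := hf (insert j x.1); have := hf (insert j x.2)
      split_ifs <;> positivity
  refine le_trans (le_of_eq ?_) (Finset.sum_le_sum step)
  symm
  rw [Finset.sum_comm]
  refine Finset.sum_congr rfl fun A hA => ?_
  rw [Finset.sum_comm]
  refine Finset.sum_congr rfl fun B hB => ?_
  rw [Finset.sum_ite_eq, if_pos]
  exact Finset.mem_powerset.2 (Finset.inter_subset_left.trans (Finset.mem_powerset.1 hA))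

/-- The probability that `i` belongs to a sample. -/
noncomputable def marg (f : Finset ι → ℝ) (S : Finset ι) (i : ι) : ℝ :=
  ∑ A ∈ S.powerset, if i ∈ A then f A else 0

lemma main_ineq (S : Finset ι) : ∀ f : Finset ι → ℝ, (∀ A, 0 ≤ f A) → ∑ A ∈ S.powerset, f A = 1 →
    (∀ i ∈ S, marg f S i = 0 ∨ 1 / 2 ≤ marg f S i) →
    ∑ A ∈ S.powerset, negMulLog (f A) ≤ ∑ C ∈ S.powerset, negMulLog (capLaw f S C) +
      ∑ i ∈ S, log 2 * (marg f S i * (1 - marg f S i)) := by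
  induction S using Finset.induction_on with
  | empty =>
    intro f hf h1 _
    simp at h1
    simp [capLaw, h1]
  | insert j S hj ih =>
    intro f hf h1 hm
    set g : Finset ι → ℝ := fun A => f A + f (insert j A) with hg
    have hg1 : ∑ A ∈ S.powerset, (f A + f (insert j A)) = 1 := by
      rw [Finset.sum_powerset_insert hj, ← Finset.sum_add_distrib] at h1; exact h1
    have hmarg : ∀ i ∈ S, marg g S i = marg f (insert j S) i := by
      intro i hi
      have hij : i ≠ j := fun h => hj (h ▸ hi)
      unfold marg
      rw [Finset.sum_powerset_insert hj, ← Finset.sum_add_distrib]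
      refine Finset.sum_congr rfl fun A hA => ?_
      by_cases h : i ∈ A <;> simp [h, hij, hg]
    have hmj : marg f (insert j S) j = ∑ A ∈ S.powerset, f (insert j A) := by
      unfold marg
      rw [Finset.sum_powerset_insert hj, ← Finset.sum_add_distrib]
      refine Finset.sum_congr rfl fun A hA => ?_
      have : j ∉ A := fun h => hj (Finset.mem_powerset.1 hA h)
      simp [this]
    have IH := ih g (fun A => add_nonneg (hf _) (hf _)) hg1 (by
      intro i hi; rw [hmarg i hi]; exact hm i (Finset.mem_insert_of_mem hi))
    have hcs := coord_step S.powerset f (fun A => f (insert j A)) hf (fun A => hf _) hg1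
      (by have := hm j (Finset.mem_insert_self _ _); rwa [hmj] at this)
    rw [← hmj] at hcs
    have hc := hTwo_capLaw hj f hf
    have hq : ∀ C ∈ S.powerset, capLaw f (insert j S) C + capLaw f (insert j S) (insert j C) = capLaw g S C := by
      intro C hC
      rw [capLaw_one hj f (Finset.mem_powerset.1 hC), capLaw_zero hj f (Finset.mem_powerset.1 hC)]
      unfold capLaw
      simp only [← Finset.sum_add_distrib]
      refine Finset.sum_congr rfl fun A hA => Finset.sum_congr rfl fun B hB => ?_
      split_ifs
      · simp only [hg]; ring
      · simp
    have e1 : ∑ A ∈ (insert j S).powerset, negMulLog (f A) =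
        ∑ A ∈ S.powerset, hTwo (f A) (f (insert j A)) + ∑ A ∈ S.powerset, negMulLog (g A) := by
      rw [Finset.sum_powerset_insert hj]
      simp only [← Finset.sum_add_distrib]
      refine Finset.sum_congr rfl fun A hA => ?_
      simp only [hTwo, hg]; ring
    have e2 : ∑ C ∈ (insert j S).powerset, negMulLog (capLaw f (insert j S) C) =
        ∑ C ∈ S.powerset, hTwo (capLaw f (insert j S) C) (capLaw f (insert j S) (insert j C))
         + ∑ C ∈ S.powerset, negMulLog (capLaw g S C) := by
      rw [Finset.sum_powerset_insert hj]
      simp only [← Finset.sum_add_distrib]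
      refine Finset.sum_congr rfl fun C hC => ?_
      rw [← hq C hC]
      simp only [hTwo]; ring
    have e3 : ∑ i ∈ S, log 2 * (marg g S i * (1 - marg g S i)) =
        ∑ i ∈ S, log 2 * (marg f (insert j S) i * (1 - marg f (insert j S) i)) :=
      Finset.sum_congr rfl fun i hi => by rw [hmarg i hi]
    rw [e1, e2, Finset.sum_insert hj, ← e3]
    linarith

/-- Summation against the law of the intersection. -/
lemma capLaw_sum (f : Finset ι → ℝ) (S : Finset ι) (φ : Finset ι → ℝ) :
    ∑ C ∈ S.powerset, capLaw f S C * φ C =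
      ∑ A ∈ S.powerset, ∑ B ∈ S.powerset, f A * f B * φ (A ∩ B) := by
  unfold capLaw
  simp only [Finset.sum_mul]
  rw [Finset.sum_comm]
  refine Finset.sum_congr rfl fun A hA => ?_
  rw [Finset.sum_comm]
  refine Finset.sum_congr rfl fun B hB => ?_
  simp only [ite_mul, zero_mul]
  rw [Finset.sum_ite_eq, if_pos]
  exact Finset.mem_powerset.2 (Finset.inter_subset_left.trans (Finset.mem_powerset.1 hA))

end

lemma gibbs_pt {q f : ℝ} (hq : 0 ≤ q) (hf : 0 < f) : negMulLog q ≤ - (q * log f) + (f - q) := by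
  rcases hq.eq_or_lt with rfl | hq
  · simp [hf.le]
  · have := log_le_sub_one_of_pos (div_pos hf hq)
    rw [log_div hf.ne' hq.ne'] at this
    have := mul_le_mul_of_nonneg_left this hq.le
    have e : q * (f / q - 1) = f - q := by field_simp
    rw [e] at this
    unfold negMulLog; linarith

/-- Weighted version for weights below `1/2`. -/
theorem weighted {n : ℕ} (x : Fin n → ℝ) (hx0 : ∀ i, 0 < x i) (hx : ∀ i, x i < 1 / 2)
    (F : Finset (Finset (Fin n)))
    (hclosed : ∀ A ∈ F, ∀ B ∈ F, A ∩ B ∈ F)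
    (hcard : 2 ≤ F.card) :
    ∃ i : Fin n, (∃ A ∈ F, i ∈ A) ∧
      (∑ A ∈ F.filter (fun A => i ∉ A), ∏ j ∈ A, x j) / (∑ A ∈ F, ∏ j ∈ A, x j) ≥ 1 / 2 := by
  by_contra! hcon
  set w : Finset (Fin n) → ℝ := fun A => ∏ j ∈ A, x j with hw
  have hwp : ∀ A, 0 < w A := fun A => Finset.prod_pos fun j _ => hx0 j
  set Z := ∑ A ∈ F, w A with hZ
  have hFne : F.Nonempty := Finset.card_pos.1 (by omega)
  have hZp : 0 < Z := Finset.sum_pos (fun A _ => hwp A) hFne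
  set f : Finset (Fin n) → ℝ := fun A => if A ∈ F then w A / Z else 0 with hf
  have hf0 : ∀ A, 0 ≤ f A := fun A => by
    have := hwp A
    simp only [hf]; split_ifs <;> positivity
  have hfpos : ∀ A ∈ F, 0 < f A := fun A hA => by
    have := hwp A
    simp only [hf, if_pos hA]; positivity
  have hfz : ∀ A, A ∉ F → f A = 0 := fun A hA => by simp only [hf, if_neg hA]
  have hsumF : ∀ φ : Finset (Fin n) → ℝ, (∀ A, A ∉ F → φ A = 0) →
      ∑ A ∈ (Finset.univ : Finset (Fin n)).powerset, φ A = ∑ A ∈ F, φ A := by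
    intro φ h
    rw [Finset.powerset_univ]
    exact (Finset.sum_subset (Finset.subset_univ _) fun A _ hA => h A hA).symm
  have h1 : ∑ A ∈ (Finset.univ : Finset (Fin n)).powerset, f A = 1 := by
    rw [hsumF f hfz]
    have : ∀ A ∈ F, f A = w A / Z := fun A hA => by simp only [hf, if_pos hA]
    rw [Finset.sum_congr rfl this, ← Finset.sum_div]
    exact div_self hZp.ne'
  have hmc : ∀ i, marg f Finset.univ i = 1 - (∑ A ∈ F.filter (fun A => i ∉ A), w A) / Z := by
    intro i
    rw [← h1]
    unfold marg
    rw [hsumF f hfz, hsumF _ (fun A hA => by simp [hfz A hA]), eq_sub_iff_add_eq, Finset.sum_div,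
      Finset.sum_filter, ← Finset.sum_add_distrib]
    refine Finset.sum_congr rfl fun A hA => ?_
    by_cases h : i ∈ A <;> simp [h, hf, hA]
  have hm : ∀ i, marg f Finset.univ i = 0 ∨ 1 / 2 ≤ marg f Finset.univ i := by
    intro i
    by_cases h : ∃ A ∈ F, i ∈ A
    · right
      have := hcon i h
      rw [hmc]; linarith
    · left
      push Not at h
      unfold marg
      refine Finset.sum_eq_zero fun A _ => ?_
      by_cases hA : A ∈ F
      · simp [h A hA]
      · simp [hfz A hA]
  have hmain := main_ineq Finset.univ f hf0 h1 (fun i _ => hm i)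
  set q := capLaw f Finset.univ with hq
  have hq0 : ∀ C, 0 ≤ q C := fun C => Finset.sum_nonneg fun A _ => Finset.sum_nonneg fun B _ => by
    have := hf0 A; have := hf0 B
    split_ifs <;> positivity
  have hqz : ∀ C, C ∉ F → q C = 0 := by
    intro C hC
    refine Finset.sum_eq_zero fun A _ => Finset.sum_eq_zero fun B _ => ?_
    split_ifs with h
    · by_cases hA : A ∈ F
      · by_cases hB : B ∈ F
        · exact absurd (h ▸ hclosed A hA B hB) hC
        · simp [hfz B hB]
      · simp [hfz A hA]
    · rfl
  have hq1 : ∑ C ∈ (Finset.univ : Finset (Fin n)).powerset, q C = 1 := by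
    have := capLaw_sum f Finset.univ (fun _ => 1)
    simp only [mul_one] at this
    rw [← hq] at this
    rw [this]
    simp only [← Finset.mul_sum, h1, mul_one]
  have hqm : ∀ i, ∑ C ∈ (Finset.univ : Finset (Fin n)).powerset, q C * (if i ∈ C then 1 else 0) =
      marg f Finset.univ i * marg f Finset.univ i := by
    intro i
    rw [hq, capLaw_sum]
    unfold marg
    rw [Finset.sum_mul_sum]
    refine Finset.sum_congr rfl fun A _ => Finset.sum_congr rfl fun B _ => ?_
    by_cases hA : i ∈ A <;> by_cases hB : i ∈ B <;> simp [hA, hB]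
  have hlogf : ∀ A ∈ F, log (f A) = ∑ i, (if i ∈ A then 1 else 0) * log (x i) - log Z := by
    intro A hA
    simp only [hf, if_pos hA, hw]
    rw [log_div (hwp A).ne' hZp.ne', log_prod (fun j _ => (hx0 j).ne')]
    simp
  have hlin : ∀ p : Finset (Fin n) → ℝ, ∑ A ∈ F, p A = 1 →
      ∑ A ∈ F, p A * log (f A) = ∑ i, (∑ A ∈ F, p A * (if i ∈ A then 1 else 0)) * log (x i) - log Z := by
    intro p hp
    have : ∀ A ∈ F, p A * log (f A) = ∑ i, p A * (if i ∈ A then 1 else 0) * log (x i) - p A * log Z := by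
      intro A hA
      rw [hlogf A hA, mul_sub, Finset.mul_sum]
      simp only [mul_assoc]
    rw [Finset.sum_congr rfl this, Finset.sum_sub_distrib, ← Finset.sum_mul, hp, one_mul, Finset.sum_comm]
    simp only [Finset.sum_mul]
  have h1' := h1
  have hq1' := hq1
  rw [hsumF f hfz] at h1'
  rw [hsumF q hqz] at hq1'
  have hfl := hlin f h1'
  have hql := hlin q hq1'
  have hfm' : ∀ i, ∑ A ∈ F, f A * (if i ∈ A then 1 else 0) = marg f Finset.univ i := by
    intro i
    unfold marg
    rw [hsumF _ (fun A hA => by simp [hfz A hA])]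
    refine Finset.sum_congr rfl fun A _ => by simp
  have hqm' : ∀ i, ∑ A ∈ F, q A * (if i ∈ A then 1 else 0) = marg f Finset.univ i * marg f Finset.univ i := by
    intro i
    rw [← hqm, hsumF _ (fun A hA => by simp [hqz A hA])]
  simp only [hfm'] at hfl
  simp only [hqm'] at hql
  rw [hsumF _ (fun A hA => by simp [hfz A hA]), hsumF _ (fun A hA => by simp [hqz A hA])] at hmain
  have hg : ∑ C ∈ F, negMulLog (q C) ≤ ∑ C ∈ F, (- (q C * log (f C)) + (f C - q C)) :=
    Finset.sum_le_sum fun C hC => gibbs_pt (hq0 C) (hfpos C hC)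
  rw [Finset.sum_add_distrib, Finset.sum_sub_distrib, Finset.sum_neg_distrib, h1', hq1'] at hg
  have hfe : ∑ A ∈ F, negMulLog (f A) = - ∑ A ∈ F, f A * log (f A) := by
    rw [← Finset.sum_neg_distrib]
    refine Finset.sum_congr rfl fun A _ => by simp [negMulLog]
  have hm1 : ∀ i, marg f Finset.univ i ≤ 1 := by
    intro i
    rw [hmc]
    have : 0 ≤ (∑ A ∈ F.filter (fun A => i ∉ A), w A) / Z :=
      div_nonneg (Finset.sum_nonneg fun A _ => (hwp A).le) hZp.le
    linarith
  have hm0 : ∀ i, 0 ≤ marg f Finset.univ i := fun i => by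
    rcases hm i with h | h <;> linarith
  have hfin : 0 ≤ ∑ i, (log 2 + log (x i)) * (marg f Finset.univ i * (1 - marg f Finset.univ i)) := by
    have e : ∑ i, (log 2 + log (x i)) * (marg f Finset.univ i * (1 - marg f Finset.univ i)) =
      ∑ i, log 2 * (marg f Finset.univ i * (1 - marg f Finset.univ i)) +
      (∑ i, marg f Finset.univ i * log (x i) - ∑ i, marg f Finset.univ i * marg f Finset.univ i * log (x i)) := by
      rw [← Finset.sum_sub_distrib, ← Finset.sum_add_distrib]
      refine Finset.sum_congr rfl fun i _ => by ring
    rw [e]; linarith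
  have hneg : ∀ i, log 2 + log (x i) < 0 := by
    intro i
    rw [← log_mul (by norm_num) (hx0 i).ne']
    exact log_neg (by linarith [hx0 i]) (by linarith [hx i])
  obtain ⟨i, hi1, hi2⟩ : ∃ i, (∃ A ∈ F, i ∈ A) ∧ ∃ B ∈ F, i ∉ B := by
    obtain ⟨A, hA, B, hB, hAB⟩ := Finset.one_lt_card.1 (show 1 < F.card by omega)
    by_contra! hno
    apply hAB
    ext i
    exact ⟨fun h => hno i ⟨A, hA, h⟩ B hB, fun h => hno i ⟨B, hB, h⟩ A hA⟩
  have hmi0 : 0 < marg f Finset.univ i := by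
    have := hcon i hi1
    rw [hmc]; linarith
  have hmi1 : marg f Finset.univ i < 1 := by
    rw [hmc]
    obtain ⟨B, hB, hiB⟩ := hi2
    have : 0 < (∑ A ∈ F.filter (fun A => i ∉ A), w A) / Z :=
      div_pos (Finset.sum_pos (fun A _ => hwp A) ⟨B, by simp [hB, hiB]⟩) hZp
    linarith
  have : ∑ i, (log 2 + log (x i)) * (marg f Finset.univ i * (1 - marg f Finset.univ i)) < 0 := by
    refine Finset.sum_neg' (fun i _ => ?_) ⟨i, Finset.mem_univ _, ?_⟩
    · exact mul_nonpos_of_nonpos_of_nonneg (hneg i).le (mul_nonneg (hm0 i) (by linarith [hm1 i]))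
    · exact mul_neg_of_neg_of_pos (hneg i) (mul_pos hmi0 (by linarith))
  linarith

theorem stmt_0 (n : ℕ) (hn : 1 ≤ n) (k m : Fin n → ℕ)
    (hk : ∀ i, 5 ≤ k i) (hm : ∀ i, 1 ≤ m i ∧ (m i : ℝ) ≤ Real.sqrt (k i))
    (F : Finset (Finset (Fin n)))
    (hclosed : ∀ A ∈ F, ∀ B ∈ F, A ∩ B ∈ F)
    (hcard : 2 ≤ F.card) :
    ∃ i : Fin n, (∃ A ∈ F, i ∈ A) ∧
      (∑ A ∈ F.filter (fun A => i ∉ A), ∏ j ∈ A, (m j : ℝ) / (k j)) /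
        (∑ A ∈ F, ∏ j ∈ A, (m j : ℝ) / (k j)) ≥ 1 / 2 := by
  refine weighted (fun j => (m j : ℝ) / (k j)) (fun i => ?_) (fun i => ?_) F hclosed hcard
  · have h1 : (1 : ℝ) ≤ m i := by exact_mod_cast (hm i).1
    have h2 : (5 : ℝ) ≤ k i := by exact_mod_cast hk i
    exact div_pos (by linarith) (by linarith)
  · have h1 : (1 : ℝ) ≤ m i := by exact_mod_cast (hm i).1
    have h2 : (5 : ℝ) ≤ k i := by exact_mod_cast hk i
    have h3 : (m i : ℝ) ^ 2 ≤ k i := (Real.le_sqrt' (by linarith)).1 (hm i).2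
    rw [div_lt_iff₀ (by linarith)]
    nlinarith
end

section
/- Let $k \geq 5$ and $1 \leq m \leq \sqrt{k}$ be integers. Then for every finite intersection-closed family $\mathcal{F}$ of finite subsets of $[n]$ with $|\mathcal{F}| \geq 2$, there exists $i \in \bigcup_{A\in\mathcal{F}} A$ such that $\frac{\sum_{A\in\mathcal{F}: i\notin A}(m/k)^{|A|}}{\sum_{A\in\mathcal{F}}(m/k)^{|A|}} \geq \frac{1}{2}$. -/
open Real

lemma diag_ineq (x : ℝ) (h0 : 0 < x) (h1 : x < 1) :
    7/5 * (x * binEntropy x) ≤ binEntropy (x * x) := by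
  have hM : x + x^2/2 ≤ -log (1 - x) := by
    have h := Real.hasSum_pow_div_log_of_abs_lt_one (x := x) (by rw [abs_of_pos h0]; exact h1)
    have h2 := sum_le_hasSum (Finset.range 2) (fun i _ => by positivity) h
    norm_num [Finset.sum_range_succ] at h2
    linarith
  have hL : 1 - x ≤ -log x := by have := Real.log_le_sub_one_of_pos h0; linarith
  have hP : (1 + x) * log (1 + x) ≤ x + x^2/2 := by
    have h := Real.self_le_sinh_iff.2 (Real.log_nonneg (x := 1 + x) (by linarith))
    rw [Real.sinh_log (by linarith)] at h
    have h2 := mul_le_mul_of_nonneg_left h (show 0 ≤ 1 + x by linarith)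
    have e : (1 + x) * ((1 + x - (1 + x)⁻¹) / 2) = x + x^2/2 := by field_simp; ring
    linarith
  have e1 : log (1 - x*x) = log (1-x) + log (1+x) := by
    rw [← Real.log_mul (by linarith) (by linarith)]; congr 1; ring
  have e2 : log (x*x) = 2 * log x := by rw [Real.log_mul h0.ne' h0.ne']; ring
  simp only [binEntropy, Real.log_inv, e1, e2]
  set L := -log x with hLd
  set M := -log (1-x) with hMd
  have : log x = -L := by simp [hLd]
  have h3 : log (1-x) = -M := by simp [hMd]
  rw [this, h3]
  have k1 : 0 ≤ (3/5*x^2) * (L - (1-x)) := by apply mul_nonneg; positivity; linarith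
  have k2 : 0 ≤ ((1-x)*(1-2/5*x)) * (M - (x+x^2/2)) := by
    apply mul_nonneg; apply mul_nonneg <;> linarith
    linarith
  have k3 : 0 ≤ (1-x) * (x + x^2/2 - (1+x)*log (1+x)) := by
    apply mul_nonneg <;> linarith
  have k4 : 0 ≤ (1-x) * (x^2 * (1 - x)) := by
    apply mul_nonneg; linarith; apply mul_nonneg; positivity; linarith
  nlinarith [k1,k2,k3,k4]

noncomputable def GG (s : ℝ) : ℝ := exp s * binEntropy (exp (-s))

lemma GG_deriv (s : ℝ) (hs : 0 < s) : HasDerivAt GG (-(log (1 - exp (-s)) / exp (-s))) s := by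
  have hx1 : exp (-s) < 1 := by rw [Real.exp_lt_one_iff]; linarith
  have hx0 := exp_pos (-s)
  have h1 : HasDerivAt (fun s : ℝ => exp (-s)) (exp (-s) * (-1)) s := (hasDerivAt_neg s).exp
  have h2 := (hasDerivAt_binEntropy hx0.ne' hx1.ne).comp s h1
  have h3 := (Real.hasDerivAt_exp s).mul h2
  refine h3.congr_deriv ?_
  have : exp s = (exp (-s))⁻¹ := by rw [Real.exp_neg, inv_inv]
  simp only [Function.comp, this, binEntropy, Real.log_inv]
  generalize exp (-s) = x at *
  field_simp
  ring

lemma psi_mono (x y : ℝ) (h0 : 0 < x) (hxy : x ≤ y) (h1 : y < 1) :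
    log (1 - y) / y ≤ log (1 - x) / x := by
  have hy : 0 < y := by linarith
  have hc := strictConcaveOn_log_Ioi.concaveOn.2
  have ha : 0 ≤ 1 - x/y := by rw [sub_nonneg, div_le_one hy]; exact hxy
  have hb : 0 ≤ x/y := by positivity
  have m1 : (1:ℝ) ∈ Set.Ioi (0:ℝ) := by simp
  have m2 : 1 - y ∈ Set.Ioi (0:ℝ) := by simp; linarith
  have := hc m1 m2 ha hb (by ring)
  simp only [smul_eq_mul, Real.log_one] at this
  have e : (1 - x / y) * 1 + x / y * (1 - y) = 1 - x := by field_simp; ring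
  rw [e] at this
  rw [le_div_iff₀ h0]
  calc _ = (1 - x/y) * 0 + x / y * log (1-y) := by ring
    _ ≤ _ := this

lemma GG_concave : ConcaveOn ℝ (Set.Ioi 0) GG := by
  apply AntitoneOn.concaveOn_of_deriv (convex_Ioi 0)
  · intro s hs; exact (GG_deriv s hs).continuousAt.continuousWithinAt
  · intro s hs; rw [interior_Ioi] at hs
    exact (GG_deriv s hs).differentiableAt.differentiableWithinAt
  · rw [interior_Ioi]
    intro s hs t ht hst
    rw [(GG_deriv s hs).deriv, (GG_deriv t ht).deriv]
    apply neg_le_neg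
    apply psi_mono _ _ (exp_pos _) (by apply exp_le_exp.2; linarith)
    rw [Real.exp_lt_one_iff]; simpa using hs

lemma bin_ineq_open (x y : ℝ) (hx0 : 0 < x) (hx1 : x < 1) (hy0 : 0 < y) (hy1 : y < 1) :
    7/10 * (x * binEntropy y + y * binEntropy x) ≤ binEntropy (x * y) := by
  obtain ⟨s, hs, rfl⟩ : ∃ s, 0 < s ∧ x = exp (-s) :=
    ⟨-log x, by have := Real.log_neg hx0 hx1; linarith, by simp [Real.exp_log hx0]⟩
  obtain ⟨t, ht, rfl⟩ : ∃ t, 0 < t ∧ y = exp (-t) :=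
    ⟨-log y, by have := Real.log_neg hy0 hy1; linarith, by simp [Real.exp_log hy0]⟩
  have hh : (0:ℝ) ≤ 1/2 := by norm_num
  have hcc := GG_concave.2
  have hc := hcc hs ht hh hh (by norm_num)
  simp only [smul_eq_mul] at hc
  have hu : 0 < 1/2*s+1/2*t := by linarith
  have e1 : exp (-s) * exp (-t) = exp (-(1/2*s+1/2*t)) * exp (-(1/2*s+1/2*t)) := by
    rw [← exp_add, ← exp_add]; congr 1; ring
  rw [e1]
  have hd := diag_ineq (exp (-(1/2*s+1/2*t))) (exp_pos _) (by rw [Real.exp_lt_one_iff]; linarith)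
  refine le_trans ?_ hd
  have hG : ∀ u, binEntropy (exp (-u)) = exp (-u) * GG u := by
    intro u; rw [GG, ← mul_assoc, ← exp_add]; simp
  rw [hG, hG, hG]
  have : exp (-(1/2*s+1/2*t)) * (exp (-(1/2*s+1/2*t)) * GG (1/2*s+1/2*t)) =
    exp (-s) * exp (-t) * GG (1/2*s+1/2*t) := by rw [e1]; ring
  rw [this]
  have hp : 0 < exp (-s) * exp (-t) := by positivity
  have := mul_le_mul_of_nonneg_left hc hp.le
  linarith

lemma bin_ineq (x y : ℝ) (hx0 : 0 ≤ x) (hx1 : x ≤ 1) (hy0 : 0 ≤ y) (hy1 : y ≤ 1) :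
    7/10 * (x * binEntropy y + y * binEntropy x) ≤ binEntropy (x * y) := by
  have a := binEntropy_nonneg hx0 hx1
  have b := binEntropy_nonneg hy0 hy1
  rcases hx0.eq_or_lt with rfl | hx0
  · simp
  rcases hy0.eq_or_lt with rfl | hy0
  · simp
  rcases hx1.eq_or_lt with rfl | hx1
  · simp; linarith
  rcases hy1.eq_or_lt with rfl | hy1
  · simp; linarith
  exact bin_ineq_open x y hx0 hx1 hy0 hy1

noncomputable def eta (u v : ℝ) : ℝ := (u + v) * binEntropy (v / (u + v))

lemma eta_eq (u v : ℝ) (hu : 0 ≤ u) (hv : 0 ≤ v) :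
    eta u v = (u+v) * log (u+v) - u * log u - v * log v := by
  rcases hu.eq_or_lt with rfl | hu
  · rcases hv.eq_or_lt with rfl | hv
    · simp [eta]
    · simp [eta, hv.ne']
  rcases hv.eq_or_lt with rfl | hv
  · simp [eta]
  have h : 0 < u + v := by linarith
  have e : 1 - v/(u+v) = u/(u+v) := by field_simp; ring
  rw [eta, binEntropy, e, log_inv, log_inv, log_div hv.ne' h.ne', log_div hu.ne' h.ne']
  field_simp
  ring

lemma frac_mem (u v : ℝ) (hu : 0 ≤ u) (hv : 0 ≤ v) : 0 ≤ v/(u+v) ∧ v/(u+v) ≤ 1 :=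
  ⟨by positivity, div_le_one_of_le₀ (by linarith) (by linarith)⟩

lemma eta_nonneg (u v : ℝ) (hu : 0 ≤ u) (hv : 0 ≤ v) : 0 ≤ eta u v := by
  obtain ⟨a, b⟩ := frac_mem u v hu hv
  exact mul_nonneg (by linarith) (binEntropy_nonneg a b)

lemma eta_le (u v : ℝ) (hu : 0 ≤ u) (hv : 0 ≤ v) : eta u v ≤ (u+v) * log 2 :=
  mul_le_mul_of_nonneg_left binEntropy_le_log_two (by linarith)

lemma eta_ineq (a b c d : ℝ) (ha : 0 ≤ a) (hb : 0 ≤ b) (hc : 0 ≤ c) (hd : 0 ≤ d) :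
    7/10 * (b * eta c d + d * eta a b) ≤ eta (a*c + a*d + b*c) (b*d) := by
  obtain ⟨x0, x1⟩ := frac_mem a b ha hb
  obtain ⟨y0, y1⟩ := frac_mem c d hc hd
  have e : a*c + a*d + b*c + b*d = (a+b)*(c+d) := by ring
  rcases (add_nonneg ha hb).eq_or_lt with h | h
  · have : a = 0 := by linarith
    have : b = 0 := by linarith
    subst a b; simp [eta]
  rcases (add_nonneg hc hd).eq_or_lt with h' | h'
  · have : c = 0 := by linarith
    have : d = 0 := by linarith
    subst c d; simp [eta]
  have key := mul_le_mul_of_nonneg_left (bin_ineq _ _ x0 x1 y0 y1) (mul_pos h h').le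
  unfold eta
  rw [e, ← div_mul_div_comm]
  refine le_trans (le_of_eq ?_) key
  field_simp


lemma gibbs (u v r s : ℝ) (hu : 0 ≤ u) (hv : 0 ≤ v) (hr : 0 ≤ r) (hs : 0 ≤ s)
    (hur : u ≠ 0 → 0 < r) (hvs : v ≠ 0 → 0 < s) :
    eta u v ≤ u * (log (r+s) - log r) + v * (log (r+s) - log s) := by
  rw [eta_eq u v hu hv]
  have key : ∀ u T r R : ℝ, 0 ≤ u → 0 < T → u ≤ T → (u ≠ 0 → 0 < r) → 0 ≤ r → r ≤ R → 0 < R →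
    u * log T - u * log u - (r * T / R - u) ≤ u * (log R - log r) := by
    intro u T r R hu hT0 hT hr hr0 hrR hR0
    rcases hu.eq_or_lt with rfl | hu
    · have : 0 ≤ r * T / R := by positivity
      simp; linarith
    have hr := hr hu.ne'
    have h := Real.log_le_sub_one_of_pos (x := r*T/(R*u)) (by positivity)
    rw [log_div (by positivity) (by positivity), log_mul hr.ne' hT0.ne', log_mul hR0.ne' hu.ne'] at h
    have h2 := mul_le_mul_of_nonneg_left h hu.le
    have : u * (r*T/(R*u) - 1) = r*T/R - u := by field_simp
    linarith
  rcases (add_nonneg hu hv).eq_or_lt with h | h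
  · have : u = 0 := by linarith
    have : v = 0 := by linarith
    subst u v; simp
  have hR : 0 < r + s := by
    by_cases hu0 : u = 0
    · have := hvs (by intro hv0; linarith)
      linarith
    · have := hur hu0; linarith
  have k1 := key u (u+v) r (r+s) hu h (by linarith) hur hr (by linarith) hR
  have k2 := key v (u+v) s (r+s) hv h (by linarith) hvs hs (by linarith) hR
  have : r * (u+v)/(r+s) + s*(u+v)/(r+s) = u+v := by field_simp
  linarith

lemma sum_cons (n : ℕ) (φ : (Fin (n+1) → Bool) → ℝ) :
    ∑ v, φ v = ∑ v : Fin n → Bool, φ (Fin.cons false v) + ∑ v : Fin n → Bool, φ (Fin.cons true v) := by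
  rw [← (Fin.consEquiv (fun _ => Bool)).sum_comp φ, Fintype.sum_prod_type, Fintype.sum_bool, add_comm]
  rfl

/-- slice of a function along the first coordinate -/
def sl {n : ℕ} (b : Bool) (f : (Fin (n+1) → Bool) → ℝ) : (Fin n → Bool) → ℝ :=
  fun v => f (Fin.cons b v)

/-- total mass -/
def tot {n : ℕ} (f : (Fin n → Bool) → ℝ) : ℝ := ∑ v, f v

/-- mass of the sets containing `i` -/
def qq {n : ℕ} (f : (Fin n → Bool) → ℝ) (i : Fin n) : ℝ := ∑ v, if v i = true then f v else 0

/-- unnormalised conditional entropy of coordinate `i` given the earlier ones -/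
noncomputable def Hc : (n : ℕ) → ((Fin n → Bool) → ℝ) → Fin n → ℝ
  | 0, _ => fun i => i.elim0
  | n+1, f => Fin.cases (eta (tot (sl false f)) (tot (sl true f)))
      (fun i => Hc n (sl false f) i + Hc n (sl true f) i)

lemma Hc_zero (n : ℕ) (f : (Fin (n+1) → Bool) → ℝ) :
    Hc (n+1) f 0 = eta (tot (sl false f)) (tot (sl true f)) := rfl

lemma Hc_succ (n : ℕ) (f : (Fin (n+1) → Bool) → ℝ) (i : Fin n) :
    Hc (n+1) f i.succ = Hc n (sl false f) i + Hc n (sl true f) i := rfl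

lemma tot_succ {n : ℕ} (f : (Fin (n+1) → Bool) → ℝ) : tot f = tot (sl false f) + tot (sl true f) :=
  sum_cons n f

lemma qq_zero {n : ℕ} (f : (Fin (n+1) → Bool) → ℝ) : qq f 0 = tot (sl true f) := by
  simp [qq, sum_cons, tot, sl]

lemma qq_succ {n : ℕ} (f : (Fin (n+1) → Bool) → ℝ) (i : Fin n) :
    qq f i.succ = qq (sl false f) i + qq (sl true f) i := by
  simp [qq, sum_cons, sl]

lemma tot_nonneg {n : ℕ} (f : (Fin n → Bool) → ℝ) (hf : ∀ v, 0 ≤ f v) : 0 ≤ tot f :=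
  Finset.sum_nonneg fun v _ => hf v

lemma qq_nonneg {n : ℕ} (f : (Fin n → Bool) → ℝ) (hf : ∀ v, 0 ≤ f v) (i) : 0 ≤ qq f i :=
  Finset.sum_nonneg fun v _ => by split_ifs; exact hf v; exact le_rfl

lemma qq_le {n : ℕ} (f : (Fin n → Bool) → ℝ) (hf : ∀ v, 0 ≤ f v) (i) : qq f i ≤ tot f :=
  Finset.sum_le_sum fun v _ => by split_ifs; exact le_rfl; exact hf v

lemma Hc_nonneg (n : ℕ) : ∀ (f : (Fin n → Bool) → ℝ), (∀ v, 0 ≤ f v) → ∀ i, 0 ≤ Hc n f i := by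
  induction n with
  | zero => intro f _ i; exact i.elim0
  | succ n ih =>
    intro f hf i
    refine Fin.cases ?_ (fun i => ?_) i
    · rw [Hc_zero]; exact eta_nonneg _ _ (tot_nonneg _ fun v => hf _) (tot_nonneg _ fun v => hf _)
    · rw [Hc_succ]; exact add_nonneg (ih _ (fun v => hf _) i) (ih _ (fun v => hf _) i)

lemma Hc_le (n : ℕ) : ∀ (f : (Fin n → Bool) → ℝ), (∀ v, 0 ≤ f v) → ∀ i, Hc n f i ≤ tot f * log 2 := by
  induction n with
  | zero => intro f _ i; exact i.elim0
  | succ n ih =>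
    intro f hf i
    rw [tot_succ]
    refine Fin.cases ?_ (fun i => ?_) i
    · rw [Hc_zero]; exact eta_le _ _ (tot_nonneg _ fun v => hf _) (tot_nonneg _ fun v => hf _)
    · rw [Hc_succ]
      have a := ih (sl false f) (fun v => hf _) i
      have b := ih (sl true f) (fun v => hf _) i
      linarith

lemma Hc_eq_zero (n : ℕ) : ∀ (f : (Fin n → Bool) → ℝ), (∀ v, 0 ≤ f v) → ∀ i, qq f i = 0 →
    Hc n f i = 0 := by
  induction n with
  | zero => intro f _ i; exact i.elim0
  | succ n ih =>
    intro f hf i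
    refine Fin.cases ?_ (fun i => ?_) i
    · rw [Hc_zero, qq_zero]; intro h; rw [h]; simp [eta]
    · rw [Hc_succ, qq_succ]; intro h
      have a := qq_nonneg (sl false f) (fun v => hf _) i
      have b := qq_nonneg (sl true f) (fun v => hf _) i
      rw [ih (sl false f) (fun v => hf _) i (by linarith), ih (sl true f) (fun v => hf _) i (by linarith),
        add_zero]

lemma Hc_sum (n : ℕ) : ∀ (f : (Fin n → Bool) → ℝ), (∀ v, 0 ≤ f v) →
    ∑ i, Hc n f i = ∑ v, f v * (log (tot f) - log (f v)) := by
  induction n with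
  | zero => intro f _; simp [tot]
  | succ n ih =>
    intro f hf
    rw [Fin.sum_univ_succ, sum_cons, Hc_zero]
    simp only [Hc_succ]
    rw [Finset.sum_add_distrib, ih (sl false f) (fun v => hf _), ih (sl true f) (fun v => hf _),
      eta_eq _ _ (tot_nonneg (sl false f) fun v => hf _) (tot_nonneg (sl true f) fun v => hf _), ← tot_succ]
    have key : ∀ b : Bool, ∑ v, sl b f v * (log (tot (sl b f)) - log (sl b f v))
       = ∑ v, f (Fin.cons b v) * (log (tot f) - log (f (Fin.cons b v)))
         - tot (sl b f) * (log (tot f) - log (tot (sl b f))) := by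
      intro b
      rw [tot, Finset.sum_mul, ← Finset.sum_sub_distrib]
      refine Finset.sum_congr rfl fun v _ => ?_
      simp only [sl, tot]; ring
    rw [key, key]
    have := tot_succ f
    have : tot f * log (tot f) = (tot (sl false f) + tot (sl true f)) * log (tot f) := by rw [← this]
    rw [this]
    ring

/-- the coordinatewise conjunction -/
def inter {n : ℕ} (u v : Fin n → Bool) : Fin n → Bool := fun i => u i && v i

lemma inter_cons {n : ℕ} (a b : Bool) (u v : Fin n → Bool) :
    inter (Fin.cons a u : Fin (n+1) → Bool) (Fin.cons b v) = Fin.cons (a && b) (inter u v) := by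
  funext i
  refine Fin.cases ?_ (fun i => ?_) i <;> simp [inter]

/-- cross entropy -/
noncomputable def cr {n : ℕ} (f g r : (Fin n → Bool) → ℝ) : ℝ :=
  ∑ u, ∑ v, f u * g v * (log (tot r) - log (r (inter u v)))

lemma cr_slice {n : ℕ} (f g r : (Fin (n+1) → Bool) → ℝ) (a b : Bool) :
    ∑ u, ∑ v, f (Fin.cons a u) * g (Fin.cons b v) *
      (log (tot r) - log (r (inter (Fin.cons a u) (Fin.cons b v)))) =
    cr (sl a f) (sl b g) (sl (a && b) r) +
      tot (sl a f) * tot (sl b g) * (log (tot r) - log (tot (sl (a && b) r))) := by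
  rw [tot.eq_1 (sl a f), tot.eq_1 (sl b g), Finset.sum_mul_sum, Finset.sum_mul, cr, ← Finset.sum_add_distrib]
  refine Finset.sum_congr rfl fun u _ => ?_
  rw [Finset.sum_mul, ← Finset.sum_add_distrib]
  refine Finset.sum_congr rfl fun v _ => ?_
  rw [inter_cons]
  simp only [sl]; ring

lemma cr_succ {n : ℕ} (f g r : (Fin (n+1) → Bool) → ℝ) :
    cr f g r = ∑ a : Bool, ∑ b : Bool, (cr (sl a f) (sl b g) (sl (a && b) r) +
      tot (sl a f) * tot (sl b g) * (log (tot r) - log (tot (sl (a && b) r)))) := by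
  simp only [← cr_slice, Fintype.sum_bool]
  unfold cr
  rw [sum_cons]
  simp only [sum_cons n (fun v => _ * g v * _), Finset.sum_add_distrib]
  ring

lemma tot_pos_of {n : ℕ} (f g r : (Fin n → Bool) → ℝ)
    (hr : ∀ v, 0 ≤ r v) (h : ∀ u v, f u ≠ 0 → g v ≠ 0 → 0 < r (inter u v))
    (hne : tot f * tot g ≠ 0) : 0 < tot r := by
  obtain ⟨u, -, hu⟩ := Finset.exists_ne_zero_of_sum_ne_zero (left_ne_zero_of_mul hne)
  obtain ⟨v, -, hv⟩ := Finset.exists_ne_zero_of_sum_ne_zero (right_ne_zero_of_mul hne)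
  exact lt_of_lt_of_le (h u v hu hv)
    (Finset.single_le_sum (f := r) (fun v _ => hr v) (Finset.mem_univ _))

lemma main_ineq_s1 (n : ℕ) : ∀ (f g r : (Fin n → Bool) → ℝ), (∀ v, 0 ≤ f v) → (∀ v, 0 ≤ g v) →
    (∀ v, 0 ≤ r v) → (∀ u v, f u ≠ 0 → g v ≠ 0 → 0 < r (inter u v)) →
    7/10 * ∑ i, (qq f i * Hc n g i + qq g i * Hc n f i) ≤ cr f g r := by
  induction n with
  | zero =>
    intro f g r _ _ _ _
    have h1 : ∀ u v : Fin 0 → Bool, tot r = r (inter u v) := by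
      intro u v
      rw [tot, Fintype.sum_unique]
      exact congrArg r (Subsingleton.elim _ _)
    have h2 : cr f g r = 0 :=
      Finset.sum_eq_zero fun u _ => Finset.sum_eq_zero fun v _ => by rw [h1 u v]; ring
    rw [h2]; simp
  | succ n ih =>
    intro f g r hf hg hr h
    have hs : ∀ a b u v, sl a f u ≠ 0 → sl b g v ≠ 0 → 0 < sl (a && b) r (inter u v) := by
      intro a b u v hu hv
      have := h _ _ hu hv
      rwa [inter_cons] at this
    have I := fun a b => ih (sl a f) (sl b g) (sl (a && b) r) (fun v => hf _) (fun v => hg _)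
      (fun v => hr _) (hs a b)
    have P := fun a b => tot_pos_of (sl a f) (sl b g) (sl (a && b) r) (fun v => hr _) (hs a b)
    have F := fun a => tot_nonneg (sl a f) (fun v => hf _)
    have G := fun a => tot_nonneg (sl a g) (fun v => hg _)
    have R := fun a => tot_nonneg (sl a r) (fun v => hr _)
    have E := eta_ineq _ _ _ _ (F false) (F true) (G false) (G true)
    have Gi := gibbs (tot (sl false f) * tot (sl false g) + tot (sl false f) * tot (sl true g)
      + tot (sl true f) * tot (sl false g)) (tot (sl true f) * tot (sl true g))
      (tot (sl false r)) (tot (sl true r))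
      (add_nonneg (add_nonneg (mul_nonneg (F _) (G _)) (mul_nonneg (F _) (G _)))
        (mul_nonneg (F _) (G _))) (mul_nonneg (F _) (G _)) (R _) (R _)
      (by
        intro hne
        by_contra hc
        have a := not_imp_comm.1 (P false false) hc
        have b := not_imp_comm.1 (P false true) hc
        have c := not_imp_comm.1 (P true false) hc
        rw [a, b, c] at hne
        simp at hne)
      (P true true)
    rw [← tot_succ r] at Gi
    rw [Fin.sum_univ_succ, cr_succ, qq_zero, qq_zero, Hc_zero, Hc_zero]
    simp only [Fintype.sum_bool, qq_succ, Hc_succ]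
    have e : ∑ i, ((qq (sl false f) i + qq (sl true f) i) * (Hc n (sl false g) i + Hc n (sl true g) i)
       + (qq (sl false g) i + qq (sl true g) i) * (Hc n (sl false f) i + Hc n (sl true f) i))
       = ∑ i, (qq (sl false f) i * Hc n (sl false g) i + qq (sl false g) i * Hc n (sl false f) i)
       + ∑ i, (qq (sl false f) i * Hc n (sl true g) i + qq (sl true g) i * Hc n (sl false f) i)
       + ∑ i, (qq (sl true f) i * Hc n (sl false g) i + qq (sl false g) i * Hc n (sl true f) i)
       + ∑ i, (qq (sl true f) i * Hc n (sl true g) i + qq (sl true g) i * Hc n (sl true f) i) := by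
      simp only [← Finset.sum_add_distrib]
      refine Finset.sum_congr rfl fun i _ => ?_
      ring
    rw [e]
    have I00 := I false false
    have I01 := I false true
    have I10 := I true false
    have I11 := I true true
    simp only [Bool.and_false, Bool.and_true] at I00 I01 I10 I11 ⊢
    linarith

/-- the set encoded by a Boolean vector -/
def toS {n : ℕ} (v : Fin n → Bool) : Finset (Fin n) := Finset.univ.filter (fun i => v i = true)

lemma mem_toS {n : ℕ} (v : Fin n → Bool) (i : Fin n) : i ∈ toS v ↔ v i = true := by simp [toS]

lemma toS_inter {n : ℕ} (u v : Fin n → Bool) : toS (inter u v) = toS u ∩ toS v := by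
  ext i; simp [toS, inter]

lemma toS_dec {n : ℕ} (A : Finset (Fin n)) : toS (fun i => decide (i ∈ A)) = A := by
  ext i; simp [toS]

lemma toS_sum {n : ℕ} (φ : Finset (Fin n) → ℝ) : ∑ v : Fin n → Bool, φ (toS v) = ∑ A, φ A := by
  refine Finset.sum_bij' (fun v _ => toS v) (fun A _ i => decide (i ∈ A)) ?_ ?_ ?_ ?_ ?_
  · simp
  · simp
  · intro v _; funext i; simp [toS]
  · intro A _; exact toS_dec A
  · simp

lemma toS_card {n : ℕ} (v : Fin n → Bool) : ((toS v).card : ℝ) = ∑ i, if v i = true then (1:ℝ) else 0 := by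
  simp [toS]

lemma log_term (c : ℝ) (hc : 6/5 * log 2 < c) (Z q H : ℝ) (hZ : 0 < Z) (hq : Z/2 < q) (hqZ : q ≤ Z)
    (hH0 : 0 ≤ H) (hH : H ≤ Z * log 2) :
    0 ≤ c * (q * (Z - q)) + (7/5 * q - Z) * H ∧ (q < Z → 0 < c * (q * (Z - q)) + (7/5 * q - Z) * H) := by
  have hl : 0 < log 2 := Real.log_pos (by norm_num)
  have hq0 : 0 < q := by linarith
  have hc0 : 0 < c := by linarith
  rcases le_or_gt Z (7/5*q) with h | h
  · have h1 : 0 ≤ (7/5 * q - Z) * H := mul_nonneg (by linarith) hH0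
    have h2 : 0 ≤ c * (q * (Z - q)) := mul_nonneg hc0.le (mul_nonneg hq0.le (by linarith))
    refine ⟨by linarith, fun hlt => ?_⟩
    have h2 : 0 < c * (q * (Z - q)) := mul_pos hc0 (mul_pos hq0 (by linarith))
    linarith
  · have hlt : q < Z := by linarith
    have h1 : (Z - 7/5 * q) * H ≤ (Z - 7/5*q) * (Z * log 2) :=
      mul_le_mul_of_nonneg_left hH (by linarith)
    have h2 : (6/5 * log 2) * (q * (Z - q)) < c * (q * (Z - q)) :=
      mul_lt_mul_of_pos_right hc (mul_pos hq0 (by linarith))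
    have h3 : (Z - 7/5*q) * Z ≤ 6/5 * (q * (Z - q)) := by nlinarith
    have h4 := mul_le_mul_of_nonneg_right h3 hl.le
    have : 0 < c * (q * (Z - q)) + (7/5 * q - Z) * H := by nlinarith
    exact ⟨this.le, fun _ => this⟩

lemma abstract_main {n : ℕ} (p : ℝ) (hp0 : 0 < p) (hp : p ≤ 2/5) (F : Finset (Finset (Fin n)))
    (hclosed : ∀ A ∈ F, ∀ B ∈ F, A ∩ B ∈ F) (f : (Fin n → Bool) → ℝ)
    (hfd : f = fun v => if toS v ∈ F then p ^ (toS v).card else 0)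
    (hq : ∀ i, qq f i = 0 ∨ tot f / 2 < qq f i)
    (hex : ∃ i, 0 < qq f i ∧ qq f i < tot f) : False := by
  have hf : ∀ v, 0 ≤ f v := by intro v; rw [hfd]; dsimp only; split_ifs <;> positivity
  have hmem : ∀ v, f v ≠ 0 → toS v ∈ F := by
    intro v hv; by_contra h; apply hv; simp [hfd, h]
  have hpos : ∀ v, toS v ∈ F → 0 < f v := by
    intro v hv; simp only [hfd, hv, if_true]; positivity
  set c := -log p with hcd
  have hc : 6/5 * log 2 < c := by
    have h1 : log p ≤ log (2/5) := Real.log_le_log hp0 hp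
    have h2 : log ((2:ℝ)^6) < log ((5/2:ℝ)^5) := Real.log_lt_log (by norm_num) (by norm_num)
    rw [Real.log_pow, Real.log_pow] at h2
    have h3 : log (2/5 : ℝ) = - log (5/2) := by rw [← Real.log_inv]; norm_num
    push_cast at h2
    linarith
  have hlog : ∀ v, toS v ∈ F → log (f v) = -(c * ∑ i, if v i = true then (1:ℝ) else 0) := by
    intro v hv
    simp only [hfd, hv, if_true]
    rw [Real.log_pow, toS_card, hcd]; ring
  set Z := tot f with hZd
  obtain ⟨i0, hi0, hi1⟩ := hex
  have hZ : 0 < Z := by linarith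
  have S1 : ∑ i, Hc n f i = Z * log Z + c * ∑ i, qq f i := by
    rw [Hc_sum n f hf]
    have : ∀ v, f v * (log Z - log (f v)) =
        f v * log Z + c * ∑ i, (if v i = true then f v else 0) := by
      intro v
      by_cases hv : f v = 0
      · simp [hv]
      · rw [hlog v (hmem v hv)]
        have : ∑ i, (if v i = true then f v else 0) = f v * ∑ i, (if v i = true then (1:ℝ) else 0) := by
          rw [Finset.mul_sum]; exact Finset.sum_congr rfl fun i _ => by split_ifs <;> ring
        rw [this]; ring
    rw [Finset.sum_congr rfl fun v _ => this v, Finset.sum_add_distrib, ← Finset.sum_mul,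
      ← Finset.mul_sum, Finset.sum_comm]
    rfl
  have S2 : cr f f f = Z^2 * log Z + c * ∑ i, (qq f i)^2 := by
    have : ∀ u v, f u * f v * (log Z - log (f (inter u v))) =
        f u * f v * log Z + c * ∑ i, (if u i = true then f u else 0) * (if v i = true then f v else 0) := by
      intro u v
      by_cases hu : f u = 0
      · simp [hu]
      by_cases hv : f v = 0
      · simp [hv]
      have hm : toS (inter u v) ∈ F := by
        rw [toS_inter]; exact hclosed _ (hmem u hu) _ (hmem v hv)
      rw [hlog _ hm]
      have : ∑ i, (if u i = true then f u else 0) * (if v i = true then f v else 0) =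
          f u * f v * ∑ i, (if inter u v i = true then (1:ℝ) else 0) := by
        rw [Finset.mul_sum]
        refine Finset.sum_congr rfl fun i _ => ?_
        by_cases h1 : u i = true <;> by_cases h2 : v i = true <;> simp [inter, h1, h2]
      rw [this]; ring
    unfold cr
    rw [Finset.sum_congr rfl fun u _ => Finset.sum_congr rfl fun v _ => this u v]
    simp only [Finset.sum_add_distrib, ← Finset.sum_mul, ← Finset.mul_sum]
    congr 1
    · rw [hZd, tot]; ring
    · congr 1
      have : ∀ u, ∑ v, ∑ i, (if u i = true then f u else 0) * (if v i = true then f v else 0)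
          = ∑ i, (if u i = true then f u else 0) * qq f i := by
        intro u
        rw [Finset.sum_comm]
        exact Finset.sum_congr rfl fun i _ => by rw [← Finset.mul_sum]; rfl
      rw [Finset.sum_congr rfl fun u _ => this u, Finset.sum_comm]
      refine Finset.sum_congr rfl fun i _ => ?_
      rw [← Finset.sum_mul, sq]; rfl
  have M := main_ineq_s1 n f f f hf hf hf (fun u v hu hv => hpos _ (by
    rw [toS_inter]; exact hclosed _ (hmem u hu) _ (hmem v hv)))
  rw [S2] at M
  have T : ∑ i, (c * (qq f i * (Z - qq f i)) + (7/5 * qq f i - Z) * Hc n f i) ≤ 0 := by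
    have : ∑ i, (c * (qq f i * (Z - qq f i)) + (7/5 * qq f i - Z) * Hc n f i)
      = c * Z * ∑ i, qq f i - c * ∑ i, (qq f i)^2
        + 7/10 * ∑ i, (qq f i * Hc n f i + qq f i * Hc n f i) - Z * ∑ i, Hc n f i := by
      simp only [Finset.mul_sum, ← Finset.sum_add_distrib, ← Finset.sum_sub_distrib]
      refine Finset.sum_congr rfl fun i _ => ?_
      ring
    rw [this, S1]
    nlinarith
  have L := fun i (h : Z/2 < qq f i) => log_term c hc Z (qq f i) (Hc n f i) hZ h (qq_le f hf i)
    (Hc_nonneg n f hf i) (Hc_le n f hf i)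
  have : 0 < ∑ i, (c * (qq f i * (Z - qq f i)) + (7/5 * qq f i - Z) * Hc n f i) := by
    refine Finset.sum_pos' (fun i _ => ?_) ⟨i0, Finset.mem_univ _, ?_⟩
    · rcases hq i with h | h
      · rw [Hc_eq_zero n f hf i h, h]; simp
      · exact (L i h).1
    · rcases hq i0 with h | h
      · linarith
      · exact (L i0 h).2 hi1
  linarith

theorem stmt_1 (k m : ℕ) (hk : 5 ≤ k) (hm1 : 1 ≤ m) (hm2 : (m : ℝ) ≤ Real.sqrt k)
    (n : ℕ) (F : Finset (Finset (Fin n)))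
    (hclosed : ∀ A ∈ F, ∀ B ∈ F, A ∩ B ∈ F)
    (hcard : 2 ≤ F.card) :
    ∃ i : Fin n, (∃ A ∈ F, i ∈ A) ∧
      (∑ A ∈ F.filter (fun A => i ∉ A), ((m : ℝ) / k) ^ A.card) /
        (∑ A ∈ F, ((m : ℝ) / k) ^ A.card) ≥ 1 / 2 := by
  have hk0 : (0:ℝ) < k := by exact_mod_cast (by omega : 0 < k)
  have hm0 : (0:ℝ) < m := by exact_mod_cast hm1
  have hp0 : 0 < (m : ℝ) / k := by positivity
  have hp : (m : ℝ) / k ≤ 2/5 := by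
    have h1 : (m:ℝ)^2 ≤ k := by
      rw [← Real.sq_sqrt hk0.le]; exact pow_le_pow_left₀ hm0.le hm2 2
    have h2 : m^2 ≤ k := by exact_mod_cast h1
    have h3 : 5 * m ≤ 2 * k := by
      rcases Nat.lt_or_ge m 3 with h | h
      · omega
      · nlinarith
    rw [div_le_div_iff₀ hk0 (by norm_num)]
    have : (5:ℝ) * m ≤ 2 * k := by exact_mod_cast h3
    linarith
  generalize (m : ℝ) / k = p at hp0 hp ⊢
  by_contra hcon
  push Not at hcon
  set f : (Fin n → Bool) → ℝ := fun v => if toS v ∈ F then p ^ (toS v).card else 0 with hfd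
  have hf : ∀ v, 0 ≤ f v := by intro v; simp only [hfd]; split_ifs <;> positivity
  have hZ : tot f = ∑ A ∈ F, p ^ A.card := by
    rw [tot, hfd, toS_sum (fun A => if A ∈ F then p ^ A.card else 0)]
    simp
  have hQ : ∀ i, qq f i = ∑ A ∈ F.filter (fun A => i ∈ A), p ^ A.card := by
    intro i
    have : qq f i = ∑ v, (fun A : Finset (Fin n) => if i ∈ A then (if A ∈ F then p ^ A.card else 0) else 0) (toS v) := by
      refine Finset.sum_congr rfl fun v _ => ?_
      simp only [mem_toS, hfd]
    rw [this, toS_sum (fun A => if i ∈ A then (if A ∈ F then p ^ A.card else 0) else 0),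
      Finset.sum_filter]
    rw [← Finset.sum_filter_add_sum_filter_not Finset.univ (fun A => A ∈ F)]
    rw [Finset.sum_eq_zero (s := Finset.univ.filter (fun A => ¬ A ∈ F)), add_zero]
    · simp only [Finset.filter_univ_mem]
      refine Finset.sum_congr rfl fun A hA => by simp [hA]
    · intro A hA
      simp at hA
      simp [hA]
  have hsplit : ∀ i, qq f i + ∑ A ∈ F.filter (fun A => i ∉ A), p ^ A.card = tot f := by
    intro i; rw [hQ, hZ]; exact Finset.sum_filter_add_sum_filter_not F _ _
  have hne : F.Nonempty := Finset.card_pos.1 (by omega)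
  have hZ0 : 0 < tot f := by rw [hZ]; exact Finset.sum_pos (fun A _ => by positivity) hne
  refine abstract_main p hp0 hp F hclosed f hfd ?_ ?_
  · intro i
    by_cases h : ∃ A ∈ F, i ∈ A
    · right
      have := hcon i h
      rw [← hZ, div_lt_iff₀ hZ0] at this
      linarith [hsplit i]
    · left
      push Not at h
      rw [hQ, Finset.filter_false_of_mem h]; simp
  · have key : ∀ A ∈ F, ∀ B ∈ F, ∀ i, i ∈ A → i ∉ B → 0 < qq f i ∧ qq f i < tot f := by
      intro A hA B hB i hiA hiB
      constructor
      · rw [hQ]; exact Finset.sum_pos (fun A _ => by positivity) ⟨A, by simp [hA, hiA]⟩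
      · have : 0 < ∑ A ∈ F.filter (fun A => i ∉ A), p ^ A.card :=
          Finset.sum_pos (fun A _ => by positivity) ⟨B, by simp [hB, hiB]⟩
        linarith [hsplit i]
    obtain ⟨A, hA, B, hB, hAB⟩ := Finset.one_lt_card.1 (by omega : 1 < F.card)
    by_cases h : A ⊆ B
    · have : ¬ B ⊆ A := fun h' => hAB (Finset.Subset.antisymm h h')
      obtain ⟨i, h1, h2⟩ := Finset.not_subset.1 this
      exact ⟨i, key B hB A hA i h1 h2⟩
    · obtain ⟨i, h1, h2⟩ := Finset.not_subset.1 h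
      exact ⟨i, key A hA B hB i h1 h2⟩
end
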